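/- Let j ∈ ℕ, let α satisfy max(0, d-2j-2) < α < d-2j, and set γ = α - d + 2j + 1 ∈ (-1,1). There exists a constant C > 0 depending only on α, d and j such that for every μ ∈ C_c^∞(ℝ^d;ℝ): if j is odd, then ∬_{ℝ^d×(0,∞)} ξ^γ |∇_x^{j+1} 𝒦_{μ,α}|² dx dξ ≤ C ∬_{ℝ^d×(0,∞)} ξ^γ |Δ_γ^{(j+1)/2} 𝒦_{μ,α}|² dx dξ; and if j is even, then ∬_{ℝ^d×(0,∞)} ξ^γ |∇_x^{j+1} 𝒦_{μ,α}|² dx dξ ≤ C ∬_{ℝ^d×(0,∞)} ξ^γ |∇_x Δ_γ^{j/2} 𝒦_{μ,α}|² dx dξ. -/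

import Mathlib

open MeasureTheory

noncomputable section

/-- The operator `Δ_γ f = Δ_{(x,ξ)} f + (γ/ξ) ∂_ξ f` on functions on `ℝ^d × ℝ`
(relevant on the upper half-space `ξ > 0`). -/
noncomputable def dgamma (d : ℕ) (γ : ℝ)
    (f : EuclideanSpace ℝ (Fin d) × ℝ → ℝ)
    (p : EuclideanSpace ℝ (Fin d) × ℝ) : ℝ :=
  (∑ i : Fin d,
      fderiv ℝ (fun q => fderiv ℝ f q (EuclideanSpace.single i 1, 0)) p
        (EuclideanSpace.single i 1, 0))
    + fderiv ℝ (fun q => fderiv ℝ f q (0, 1)) p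
        ((0 : EuclideanSpace ℝ (Fin d)), (1 : ℝ))
    + γ / p.2 * fderiv ℝ f p ((0 : EuclideanSpace ℝ (Fin d)), (1 : ℝ))

/-- The partial derivative `∂_{x_i}` of a function on `ℝ^d × ℝ`. -/
noncomputable def dX (d : ℕ) (i : Fin d) (g : EuclideanSpace ℝ (Fin d) × ℝ → ℝ)
    (p : EuclideanSpace ℝ (Fin d) × ℝ) : ℝ :=
  fderiv ℝ g p (EuclideanSpace.single i 1, 0)

/-- Iterated `x`-partial derivatives along a tuple of coordinate indices. -/
noncomputable def dXIter (d : ℕ) {p : ℕ} (js : Fin p → Fin d)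
    (g : EuclideanSpace ℝ (Fin d) × ℝ → ℝ) : EuclideanSpace ℝ (Fin d) × ℝ → ℝ :=
  (List.ofFn js).foldr (fun i h => dX d i h) g

/-- The extended potential `𝒦_{μ,β}(x,ξ) = ∫ |(x-y,ξ)|^{-β} μ(y) dy` on the upper
half-space. -/
noncomputable def Kext (d : ℕ) (β : ℝ) (μ : EuclideanSpace ℝ (Fin d) → ℝ)
    (p : EuclideanSpace ℝ (Fin d) × ℝ) : ℝ :=
  ∫ y, (‖p.1 - y‖ ^ 2 + p.2 ^ 2) ^ (-β / 2) * μ y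

/-- The open upper half-space `ℝ^d × (0, ∞)`. -/
def upperHalf (d : ℕ) : Set (EuclideanSpace ℝ (Fin d) × ℝ) := {q | 0 < q.2}

/-- The partial convolution in `x` of a function on `ℝ^d × ℝ` with a density `μ`. -/
def partialConv (d : ℕ) (μ : EuclideanSpace ℝ (Fin d) → ℝ)
    (g : EuclideanSpace ℝ (Fin d) × ℝ → ℝ) (p : EuclideanSpace ℝ (Fin d) × ℝ) : ℝ :=
  ∫ y, g (p - (y, 0)) * μ y

lemma isOpen_upperHalf (d : ℕ) : IsOpen (upperHalf d) :=
  isOpen_lt continuous_const continuous_snd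

lemma sub_mem_upperHalf {d : ℕ} {p : EuclideanSpace ℝ (Fin d) × ℝ} (hp : p ∈ upperHalf d)
    (y : EuclideanSpace ℝ (Fin d)) : p - (y, 0) ∈ upperHalf d := by
  simpa [upperHalf] using hp

lemma continuous_comp_sub_mul {d : ℕ} {F : Type*} [NormedAddCommGroup F] [NormedSpace ℝ F]
    {μ : EuclideanSpace ℝ (Fin d) → ℝ}
    {g : EuclideanSpace ℝ (Fin d) × ℝ → F} (hg : ContinuousOn g (upperHalf d))
    (hμ : Continuous μ) {p : EuclideanSpace ℝ (Fin d) × ℝ} (hp : p ∈ upperHalf d) :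
    Continuous fun y => μ y • g (p - (y, 0)) := by
  refine hμ.smul (hg.comp_continuous (by fun_prop) fun y => sub_mem_upperHalf hp y)

lemma integrable_comp_sub_mul {d : ℕ} {F : Type*} [NormedAddCommGroup F] [NormedSpace ℝ F]
    {μ : EuclideanSpace ℝ (Fin d) → ℝ}
    {g : EuclideanSpace ℝ (Fin d) × ℝ → F} (hg : ContinuousOn g (upperHalf d))
    (hμ : Continuous μ) (hc : HasCompactSupport μ)
    {p : EuclideanSpace ℝ (Fin d) × ℝ} (hp : p ∈ upperHalf d) :
    Integrable fun y => μ y • g (p - (y, 0)) :=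
  (continuous_comp_sub_mul hg hμ hp).integrable_of_hasCompactSupport hc.smul_right

lemma hasFDerivAt_partialConv {d : ℕ} {μ : EuclideanSpace ℝ (Fin d) → ℝ}
    {g : EuclideanSpace ℝ (Fin d) × ℝ → ℝ} (hg : ContDiffOn ℝ 1 g (upperHalf d))
    (hμ : Continuous μ) (hc : HasCompactSupport μ)
    {p : EuclideanSpace ℝ (Fin d) × ℝ} (hp : p ∈ upperHalf d) :
    HasFDerivAt (partialConv d μ g) (∫ y, μ y • fderiv ℝ g (p - (y, 0))) p := by
  have hU := isOpen_upperHalf d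
  have hg' : ContinuousOn (fderiv ℝ g) (upperHalf d) :=
    hg.continuousOn_fderiv_of_isOpen hU le_rfl
  obtain ⟨ε, hε, hball⟩ := Metric.nhds_basis_closedBall.mem_iff.1 (hU.mem_nhds hp)
  set K : Set (EuclideanSpace ℝ (Fin d) × ℝ) :=
    (fun z : (EuclideanSpace ℝ (Fin d) × ℝ) × EuclideanSpace ℝ (Fin d) => z.1 - (z.2, 0)) ''
      (Metric.closedBall p ε ×ˢ tsupport μ) with hK
  have hKc : IsCompact K :=
    ((isCompact_closedBall p ε).prod hc).image (by fun_prop)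
  have hKU : K ⊆ upperHalf d := by
    rintro _ ⟨z, hz, rfl⟩
    exact sub_mem_upperHalf (hball hz.1) _
  obtain ⟨C, hC⟩ := hKc.exists_bound_of_continuousOn (hg'.mono hKU)
  have h0 : partialConv d μ g = fun x => ∫ y, μ y • g (x - (y, 0)) := by
    funext x
    simp [partialConv, mul_comm]
  rw [h0]
  refine hasFDerivAt_integral_of_dominated_of_fderiv_le (s := Metric.closedBall p ε)
    (F := fun x y => μ y • g (x - (y, 0)))
    (F' := fun x y => μ y • fderiv ℝ g (x - (y, 0))) (bound := fun y => ‖μ y‖ * C)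
    (Metric.closedBall_mem_nhds p hε) ?_ ?_ ?_ ?_ ?_ ?_
  · filter_upwards [hU.mem_nhds hp] with x hx
    exact (continuous_comp_sub_mul hg.continuousOn hμ hx).aestronglyMeasurable
  · exact integrable_comp_sub_mul hg.continuousOn hμ hc hp
  · exact (continuous_comp_sub_mul hg' hμ hp).aestronglyMeasurable
  · refine Filter.Eventually.of_forall fun y x hx => ?_
    rw [norm_smul]
    by_cases hy : y ∈ tsupport μ
    · exact mul_le_mul_of_nonneg_left (hC _ ⟨(x, y), ⟨hx, hy⟩, rfl⟩) (norm_nonneg _)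
    · simp [image_eq_zero_of_notMem_tsupport hy]
  · exact ((hμ.integrable_of_hasCompactSupport hc).norm).mul_const C
  · refine Filter.Eventually.of_forall fun y x hx => ?_
    have h1 : HasFDerivAt g (fderiv ℝ g (x - (y, 0))) (x - (y, 0)) :=
      ((hg.contDiffAt (hU.mem_nhds (sub_mem_upperHalf (hball hx) y))).differentiableAt
        one_ne_zero).hasFDerivAt
    exact (h1.comp x ((hasFDerivAt_id x).sub_const (y, 0))).const_smul (μ y)

lemma fderiv_partialConv_apply {d : ℕ} {μ : EuclideanSpace ℝ (Fin d) → ℝ}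
    {g : EuclideanSpace ℝ (Fin d) × ℝ → ℝ} (hg : ContDiffOn ℝ 1 g (upperHalf d))
    (hμ : Continuous μ) (hc : HasCompactSupport μ) (v : EuclideanSpace ℝ (Fin d) × ℝ)
    {p : EuclideanSpace ℝ (Fin d) × ℝ} (hp : p ∈ upperHalf d) :
    fderiv ℝ (partialConv d μ g) p v = partialConv d μ (fun q => fderiv ℝ g q v) p := by
  rw [(hasFDerivAt_partialConv hg hμ hc hp).fderiv, ContinuousLinearMap.integral_apply]
  · simp [partialConv, mul_comm]
  · exact integrable_comp_sub_mul
      (hg.continuousOn_fderiv_of_isOpen (isOpen_upperHalf d) le_rfl) hμ hc hp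

lemma fderiv_apply_congr_of_eqOn {E : Type*} [NormedAddCommGroup E] [NormedSpace ℝ E]
    {s : Set E} (hs : IsOpen s) {f g : E → ℝ} (h : Set.EqOn f g s) (v : E) :
    Set.EqOn (fun q => fderiv ℝ f q v) (fun q => fderiv ℝ g q v) s := fun q hq => by
  simp only [(h.eventuallyEq_of_mem (hs.mem_nhds hq)).fderiv_eq]

lemma contDiffOn_fderiv_apply {E : Type*} [NormedAddCommGroup E] [NormedSpace ℝ E]
    {s : Set E} (hs : IsOpen s) {f : E → ℝ} (h : ContDiffOn ℝ (⊤ : ℕ∞) f s) (v : E) :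
    ContDiffOn ℝ (⊤ : ℕ∞) (fun q => fderiv ℝ f q v) s :=
  (h.fderiv_of_isOpen hs (by simp)).clm_apply contDiffOn_const

lemma contDiffOn_dXIter {d n : ℕ} (js : Fin n → Fin d)
    {s : Set (EuclideanSpace ℝ (Fin d) × ℝ)} (hs : IsOpen s)
    {g : EuclideanSpace ℝ (Fin d) × ℝ → ℝ} (hg : ContDiffOn ℝ (⊤ : ℕ∞) g s) :
    ContDiffOn ℝ (⊤ : ℕ∞) (dXIter d js g) s := by
  unfold dXIter
  induction List.ofFn js with
  | nil => exact hg
  | cons i l ih => exact contDiffOn_fderiv_apply hs ih _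

lemma dXIter_partialConv {d n : ℕ} (js : Fin n → Fin d) {μ : EuclideanSpace ℝ (Fin d) → ℝ}
    {g : EuclideanSpace ℝ (Fin d) × ℝ → ℝ} (hg : ContDiffOn ℝ (⊤ : ℕ∞) g (upperHalf d))
    (hμ : Continuous μ) (hc : HasCompactSupport μ) :
    Set.EqOn (dXIter d js (partialConv d μ g)) (partialConv d μ (dXIter d js g))
      (upperHalf d) := by
  have key : ∀ l : List (Fin d),
      ContDiffOn ℝ (⊤ : ℕ∞) (l.foldr (fun i h => dX d i h) g) (upperHalf d) ∧
      Set.EqOn (l.foldr (fun i h => dX d i h) (partialConv d μ g))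
        (partialConv d μ (l.foldr (fun i h => dX d i h) g)) (upperHalf d) := by
    intro l
    induction l with
    | nil => exact ⟨hg, fun _ _ => rfl⟩
    | cons i l ih =>
      refine ⟨contDiffOn_fderiv_apply (isOpen_upperHalf d) ih.1 _, fun q hq => ?_⟩
      refine (fderiv_apply_congr_of_eqOn (isOpen_upperHalf d) ih.2 _ hq).trans ?_
      exact fderiv_partialConv_apply (ih.1.of_le (by simp)) hμ hc _ hq
  exact (key _).2

lemma dgamma_congr_of_eqOn {d : ℕ} (γ : ℝ) {f g : EuclideanSpace ℝ (Fin d) × ℝ → ℝ}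
    (h : Set.EqOn f g (upperHalf d)) :
    Set.EqOn (dgamma d γ f) (dgamma d γ g) (upperHalf d) := fun q hq => by
  have hU := isOpen_upperHalf d
  have h2 := fun v => fderiv_apply_congr_of_eqOn hU (fderiv_apply_congr_of_eqOn hU h v) v hq
  have h1 := fun v => fderiv_apply_congr_of_eqOn hU h v hq
  simp only at h1 h2
  simp only [dgamma, h1, h2]

lemma dgamma_partialConv {d : ℕ} (γ : ℝ) {μ : EuclideanSpace ℝ (Fin d) → ℝ}
    {g : EuclideanSpace ℝ (Fin d) × ℝ → ℝ} (hg : ContDiffOn ℝ (⊤ : ℕ∞) g (upperHalf d))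
    (hμ : Continuous μ) (hc : HasCompactSupport μ) :
    Set.EqOn (dgamma d γ (partialConv d μ g)) (partialConv d μ (dgamma d γ g))
      (upperHalf d) := fun q hq => by
  have hU := isOpen_upperHalf d
  have h1 := fun v => fderiv_partialConv_apply (hg.of_le (by simp)) hμ hc v hq
  have hd := fun v => contDiffOn_fderiv_apply hU hg v
  have h2 : ∀ v, fderiv ℝ (fun q => fderiv ℝ (partialConv d μ g) q v) q v =
      partialConv d μ (fun q => fderiv ℝ (fun q => fderiv ℝ g q v) q v) q := fun v => by
    refine (fderiv_apply_congr_of_eqOn hU (fun x hx =>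
      fderiv_partialConv_apply (hg.of_le (by simp)) hμ hc v hx) v hq).trans ?_
    exact fderiv_partialConv_apply ((hd v).of_le (by simp)) hμ hc v hq
  have i1 := fun v => integrable_comp_sub_mul (hd v).continuousOn hμ hc hq
  have i2 := fun v =>
    integrable_comp_sub_mul (contDiffOn_fderiv_apply hU (hd v) v).continuousOn hμ hc hq
  simp only [dgamma, h1, h2, partialConv, Prod.snd_sub, sub_zero]
  simp only [smul_eq_mul, mul_comm (μ _)] at i1 i2
  simp only [add_mul, Finset.sum_mul, mul_assoc]
  have i3 := integrable_finsetSum Finset.univ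
    fun (i : Fin d) _ => i2 (EuclideanSpace.single i 1, 0)
  refine Eq.symm ((integral_add (i3.add (i2 (0, 1))) ((i1 (0, 1)).const_mul (γ / q.2))).trans ?_)
  refine congrArg₂ (· + ·) ((integral_add i3 (i2 (0, 1))).trans ?_) (integral_const_mul _ _)
  rw [integral_finsetSum _ fun i _ => i2 _]

lemma dXIter_cons {d n : ℕ} (js : Fin (n + 1) → Fin d)
    (g : EuclideanSpace ℝ (Fin d) × ℝ → ℝ) :
    dXIter d js g = dX d (js 0) (dXIter d (Fin.tail js) g) := by
  simp only [dXIter, List.ofFn_succ, List.foldr_cons]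
  rfl

lemma dXIter_eq_iteratedFDeriv {d n : ℕ} (js : Fin n → Fin d)
    {s : Set (EuclideanSpace ℝ (Fin d) × ℝ)} (hs : IsOpen s)
    {g : EuclideanSpace ℝ (Fin d) × ℝ → ℝ} (hg : ContDiffOn ℝ (⊤ : ℕ∞) g s) :
    Set.EqOn (dXIter d js g)
      (fun p => iteratedFDeriv ℝ n g p fun i => (EuclideanSpace.single (js i) 1, 0)) s := by
  induction n with
  | zero => intro p _; simp [dXIter]
  | succ n ih =>
    intro p hp
    rw [dXIter_cons]
    refine (fderiv_apply_congr_of_eqOn hs (ih (Fin.tail js)) _ hp).trans ?_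
    have hd : DifferentiableAt ℝ (iteratedFDeriv ℝ n g) p :=
      (hg.contDiffAt (hs.mem_nhds hp)).differentiableAt_iteratedFDeriv
        (by exact_mod_cast ENat.natCast_lt_top n)
    simp only [iteratedFDeriv_succ_apply_left]
    have := (ContinuousMultilinearMap.apply ℝ (fun _ : Fin n => EuclideanSpace ℝ (Fin d) × ℝ) ℝ
      (fun i => (EuclideanSpace.single (Fin.tail js i) 1, 0))).hasFDerivAt.comp p hd.hasFDerivAt
    have h2 := this.fderiv
    simp only [Function.comp_def, ContinuousMultilinearMap.apply_apply] at h2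
    rw [h2]
    rfl

lemma sum_multilinear_mul_eq_of_orthonormalBasis {ι : Type*} [Fintype ι] [DecidableEq ι]
    {E : Type*} [NormedAddCommGroup E] [InnerProductSpace ℝ E] {n : ℕ}
    (A B : MultilinearMap ℝ (fun _ : Fin n => E) ℝ) (e u : OrthonormalBasis ι ℝ E) :
    ∑ js : Fin n → ι, A (fun i => u (js i)) * B (fun i => u (js i)) =
      ∑ js : Fin n → ι, A (fun i => e (js i)) * B (fun i => e (js i)) := by
  have expand : ∀ (A : MultilinearMap ℝ (fun _ : Fin n => E) ℝ) (js : Fin n → ι),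
      A (fun i => u (js i)) =
        ∑ ks : Fin n → ι, (∏ i, inner ℝ (e (ks i)) (u (js i))) * A (fun i => e (ks i)) := by
    intro A js
    conv_lhs => rw [show (fun i => u (js i)) =
      fun i => ∑ k, inner ℝ (e k) (u (js i)) • e k from funext fun i => (e.sum_repr' _).symm]
    rw [MultilinearMap.map_sum]
    simp [MultilinearMap.map_smul_univ]
  have orth : ∀ ks ls : Fin n → ι,
      ∑ js : Fin n → ι, (∏ i, inner ℝ (e (ks i)) (u (js i))) * (∏ i, inner ℝ (e (ls i)) (u (js i)))
        = if ks = ls then 1 else 0 := by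
    intro ks ls
    simp only [← Finset.prod_mul_distrib]
    have h := Finset.prod_univ_sum (fun _ : Fin n => (Finset.univ : Finset ι))
      (fun i j => inner ℝ (e (ks i)) (u j) * inner ℝ (e (ls i)) (u j))
    rw [Fintype.piFinset_univ] at h
    rw [← h]
    have h3 : ∀ i, ∑ j, inner ℝ (e (ks i)) (u j) * inner ℝ (e (ls i)) (u j) =
        if ks i = ls i then (1 : ℝ) else 0 := fun i => by
      rw [← orthonormal_iff_ite.1 e.orthonormal, ← u.sum_inner_mul_inner]
      exact Finset.sum_congr rfl fun j _ => by rw [real_inner_comm (u j) (e (ls i))]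
    simp only [h3, Finset.prod_ite_zero, Finset.prod_const_one]
    simp [funext_iff]
  calc _ = ∑ js : Fin n → ι, ∑ ks : Fin n → ι, ∑ ls : Fin n → ι,
        ((∏ i, inner ℝ (e (ks i)) (u (js i))) * (∏ i, inner ℝ (e (ls i)) (u (js i)))) *
          (A (fun i => e (ks i)) * B (fun i => e (ls i))) := by
        refine Finset.sum_congr rfl fun js _ => ?_
        rw [expand A, expand B, Finset.sum_mul_sum]
        exact Finset.sum_congr rfl fun _ _ => Finset.sum_congr rfl fun _ _ => by ring
    _ = ∑ ks : Fin n → ι, ∑ ls : Fin n → ι, (if ks = ls then 1 else 0) *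
          (A (fun i => e (ks i)) * B (fun i => e (ls i))) := by
        rw [Finset.sum_comm]
        refine Finset.sum_congr rfl fun ks _ => ?_
        rw [Finset.sum_comm]
        refine Finset.sum_congr rfl fun ls _ => ?_
        rw [← orth, Finset.sum_mul]
    _ = _ := by simp

/-- The pointwise Frobenius product of the `n`-th `x`-derivative tensors of `g` at `a` and `b`. -/
def frobeniusX (d n : ℕ) (g : EuclideanSpace ℝ (Fin d) × ℝ → ℝ)
    (a b : EuclideanSpace ℝ (Fin d) × ℝ) : ℝ :=
  ∑ js : Fin n → Fin d, dXIter d js g a * dXIter d js g b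

lemma frobeniusX_isometry {d n : ℕ} {s : Set (EuclideanSpace ℝ (Fin d) × ℝ)} (hs : IsOpen s)
    {g : EuclideanSpace ℝ (Fin d) × ℝ → ℝ} (hg : ContDiffOn ℝ (⊤ : ℕ∞) g s)
    (V : EuclideanSpace ℝ (Fin d) ≃ₗᵢ[ℝ] EuclideanSpace ℝ (Fin d))
    (hV : ∀ p, g (V p.1, p.2) = g p) {a b : EuclideanSpace ℝ (Fin d) × ℝ}
    (ha : a ∈ s) (hb : b ∈ s) (ha' : (V a.1, a.2) ∈ s) (hb' : (V b.1, b.2) ∈ s) :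
    frobeniusX d n g (V a.1, a.2) (V b.1, b.2) = frobeniusX d n g a b := by
  set W : (EuclideanSpace ℝ (Fin d) × ℝ) ≃L[ℝ] (EuclideanSpace ℝ (Fin d) × ℝ) :=
    V.toContinuousLinearEquiv.prodCongr (ContinuousLinearEquiv.refl ℝ ℝ) with hW
  have hWg : g ∘ W = g := funext hV
  have hcomp : ∀ p, iteratedFDeriv ℝ n g p =
      (iteratedFDeriv ℝ n g (V p.1, p.2)).compContinuousLinearMap fun _ => W := fun p => by
    have := W.iteratedFDerivWithin_comp_right (𝕜 := ℝ) g uniqueDiffOn_univ (Set.mem_univ (W p)) n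
    rw [Set.preimage_univ, iteratedFDerivWithin_univ, iteratedFDerivWithin_univ, hWg] at this
    exact this
  let ins : EuclideanSpace ℝ (Fin d) →ₗ[ℝ] EuclideanSpace ℝ (Fin d) × ℝ := LinearMap.inl ℝ _ _
  let T : (EuclideanSpace ℝ (Fin d) × ℝ) → MultilinearMap ℝ
      (fun _ : Fin n => EuclideanSpace ℝ (Fin d)) ℝ := fun p =>
    (iteratedFDeriv ℝ n g p).toMultilinearMap.compLinearMap fun _ => ins
  let e := EuclideanSpace.basisFun (Fin d) ℝ
  have key := sum_multilinear_mul_eq_of_orthonormalBasis (T (V a.1, a.2)) (T (V b.1, b.2))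
    e (e.map V)
  have h1 : ∀ p ∈ s, ∀ js : Fin n → Fin d, dXIter d js g p = T p fun i => e (js i) :=
    fun p hp js => by
      rw [dXIter_eq_iteratedFDeriv js hs hg hp]
      simp [T, e, ins]
  have h2 : ∀ (p) (js : Fin n → Fin d), (T (V p.1, p.2) fun i => (e.map V) (js i)) =
      T p fun i => e (js i) := fun p js => by
    simp only [T, MultilinearMap.compLinearMap_apply, ContinuousMultilinearMap.coe_coe, hcomp p]
    rw [ContinuousMultilinearMap.compContinuousLinearMap_apply]
    rfl
  simp only [frobeniusX, h1 _ ha, h1 _ hb, h1 _ ha', h1 _ hb']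
  rw [← key]
  simp only [h2]

/-- The Riesz kernel `|(x, ξ)|^{-β}` on `ℝ^d × ℝ`. -/
def rieszKer (d : ℕ) (β : ℝ) (p : EuclideanSpace ℝ (Fin d) × ℝ) : ℝ :=
  (‖p.1‖ ^ 2 + p.2 ^ 2) ^ (-β / 2)

lemma Kext_eq_partialConv (d : ℕ) (β : ℝ) (μ : EuclideanSpace ℝ (Fin d) → ℝ) :
    Kext d β μ = partialConv d μ (rieszKer d β) := by
  funext p
  simp [Kext, partialConv, rieszKer]

lemma norm_sq_add_sq_pos {d : ℕ} {p : EuclideanSpace ℝ (Fin d) × ℝ} (hp : p ≠ 0) :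
    0 < ‖p.1‖ ^ 2 + p.2 ^ 2 := by
  rcases eq_or_ne p.1 0 with h | h
  · have : p.2 ≠ 0 := fun h2 => hp (Prod.ext h h2)
    positivity
  · positivity

lemma upperHalf_subset_compl_zero (d : ℕ) : upperHalf d ⊆ {0}ᶜ := by
  rintro p hp rfl
  exact lt_irrefl (0 : ℝ) hp

lemma contDiffOn_rieszKer (d : ℕ) (β : ℝ) :
    ContDiffOn ℝ (⊤ : ℕ∞) (rieszKer d β) {0}ᶜ := by
  refine ContDiffOn.rpow_const_of_ne ?_ fun p hp => (norm_sq_add_sq_pos hp).ne'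
  exact ((contDiff_fst.norm_sq ℝ).add (contDiff_snd.pow 2)).contDiffOn

lemma contDiffOn_upperHalf_rieszKer (d : ℕ) (β : ℝ) :
    ContDiffOn ℝ (⊤ : ℕ∞) (rieszKer d β) (upperHalf d) :=
  (contDiffOn_rieszKer d β).mono (upperHalf_subset_compl_zero d)

lemma fderiv_rieszKer_apply {d : ℕ} (β : ℝ) {p : EuclideanSpace ℝ (Fin d) × ℝ} (hp : p ≠ 0)
    (v : EuclideanSpace ℝ (Fin d) × ℝ) :
    fderiv ℝ (rieszKer d β) p v =
      -β * (inner ℝ p.1 v.1 + p.2 * v.2) * rieszKer d (β + 2) p := by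
  have h1 : HasFDerivAt (fun p : EuclideanSpace ℝ (Fin d) × ℝ => ‖p.1‖ ^ 2 + p.2 ^ 2) _ p :=
    (hasFDerivAt_fst (𝕜 := ℝ) (p := p)).norm_sq.add
      ((hasFDerivAt_snd (𝕜 := ℝ) (p := p)).pow 2)
  have h2 := h1.rpow_const (p := -β / 2) (Or.inl (norm_sq_add_sq_pos hp).ne')
  have h3 := h2.fderiv
  change fderiv ℝ (rieszKer d β) p = _ at h3
  rw [h3]
  simp only [rieszKer, show -(β + 2) / 2 = -β / 2 - 1 by ring]
  simp
  ring

lemma fderiv_fderiv_rieszKer_apply {d : ℕ} (β : ℝ) {p : EuclideanSpace ℝ (Fin d) × ℝ}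
    (hp : p ≠ 0) (v : EuclideanSpace ℝ (Fin d) × ℝ) :
    fderiv ℝ (fun q => fderiv ℝ (rieszKer d β) q v) p v =
      -β * (inner ℝ v.1 v.1 + v.2 * v.2) * rieszKer d (β + 2) p +
        β * (β + 2) * (inner ℝ p.1 v.1 + p.2 * v.2) ^ 2 * rieszKer d (β + 4) p := by
  have hO : IsOpen ({0}ᶜ : Set (EuclideanSpace ℝ (Fin d) × ℝ)) := isOpen_compl_singleton
  refine (fderiv_apply_congr_of_eqOn hO (fun q hq => fderiv_rieszKer_apply β hq v) v hp).trans ?_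
  have hk : HasFDerivAt (rieszKer d (β + 2)) (fderiv ℝ (rieszKer d (β + 2)) p) p :=
    (((contDiffOn_rieszKer d (β + 2)).contDiffAt (hO.mem_nhds hp)).differentiableAt
      (by simp)).hasFDerivAt
  have hl : HasFDerivAt
      (fun q : EuclideanSpace ℝ (Fin d) × ℝ => -β * (inner ℝ q.1 v.1 + q.2 * v.2)) _ p :=
    (((hasFDerivAt_fst (𝕜 := ℝ) (p := p)).inner ℝ (hasFDerivAt_const v.1 p)).add
      ((hasFDerivAt_snd (𝕜 := ℝ) (p := p)).mul_const v.2)).const_mul (-β)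
  have h := (hl.mul hk).fderiv
  simp only [] at h ⊢
  have h' := congrArg (fun L => L v) h
  refine h'.trans ?_
  have hk' := fderiv_rieszKer_apply (β + 2) hp v
  rw [show β + 2 + 2 = β + 4 by ring] at hk'
  simp [hk']
  ring

lemma dgamma_rieszKer {d : ℕ} (γ β : ℝ) {p : EuclideanSpace ℝ (Fin d) × ℝ}
    (hp : p ∈ upperHalf d) :
    dgamma d γ (rieszKer d β) p = β * (β + 1 - d - γ) * rieszKer d (β + 2) p := by
  have hp0 : p ≠ 0 := upperHalf_subset_compl_zero d hp
  have hp2 : p.2 ≠ 0 := ne_of_gt hp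
  simp only [dgamma, fderiv_fderiv_rieszKer_apply β hp0, fderiv_rieszKer_apply β hp0]
  have hpos := norm_sq_add_sq_pos hp0
  have hk : rieszKer d (β + 2) p = (‖p.1‖ ^ 2 + p.2 ^ 2) * rieszKer d (β + 4) p := by
    simp only [rieszKer]
    rw [show -(β + 2) / 2 = 1 + -(β + 4) / 2 by ring, Real.rpow_add hpos, Real.rpow_one]
  rw [Finset.sum_add_distrib]
  simp [EuclideanSpace.inner_single_right, ← Finset.sum_mul, ← Finset.mul_sum]
  rw [← EuclideanSpace.real_norm_sq_eq, hk]
  field_simp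
  ring

lemma rieszKer_smul {d : ℕ} (β : ℝ) {t : ℝ} (ht : 0 < t)
    (p : EuclideanSpace ℝ (Fin d) × ℝ) :
    rieszKer d β (t • p) = t ^ (-β) * rieszKer d β p := by
  simp only [rieszKer, Prod.smul_fst, Prod.smul_snd, norm_smul, Real.norm_of_nonneg ht.le,
    smul_eq_mul, mul_pow]
  rw [← mul_add, Real.mul_rpow (by positivity) (by positivity), ← Real.rpow_natCast,
    ← Real.rpow_mul ht.le]
  congr 2
  push_cast
  ring

lemma dXIter_smul {d n : ℕ} (js : Fin n → Fin d) {g : EuclideanSpace ℝ (Fin d) × ℝ → ℝ}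
    {β : ℝ} (hg : ∀ t : ℝ, 0 < t → ∀ p, g (t • p) = t ^ (-β) * g p) {t : ℝ} (ht : 0 < t)
    (p : EuclideanSpace ℝ (Fin d) × ℝ) :
    dXIter d js g (t • p) = t ^ (-(β + n)) * dXIter d js g p := by
  induction n generalizing p with
  | zero => simpa [dXIter] using hg t ht p
  | succ n ih =>
    have h := fderiv_comp_smul (𝕜 := ℝ) (f := dXIter d (Fin.tail js) g) (x := p) t
    rw [show (fun x => dXIter d (Fin.tail js) g (t • x)) =
      t ^ (-(β + n)) • dXIter d (Fin.tail js) g from funext (ih (Fin.tail js)),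
      fderiv_const_smul_field] at h
    have h' := congrArg (fun L => L (EuclideanSpace.single (js 0) 1, 0)) h
    simp only [dXIter_cons, dX]
    simp only [smul_eq_mul, smul_apply, Pi.smul_apply] at h'
    rw [show -(β + ((n + 1 : ℕ) : ℝ)) = -(β + n) - 1 by push_cast; ring,
      Real.rpow_sub ht, Real.rpow_one, div_mul_eq_mul_div, h']
    field_simp

lemma abs_dXIter_rieszKer_le {d n : ℕ} (β : ℝ) (js : Fin n → Fin d) :
    ∃ M, 0 ≤ M ∧ ∀ p ∈ upperHalf d,
      |dXIter d js (rieszKer d β) p| ≤ M * rieszKer d (β + n) p := by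
  have hO : IsOpen ({0}ᶜ : Set (EuclideanSpace ℝ (Fin d) × ℝ)) := isOpen_compl_singleton
  set S : Set (EuclideanSpace ℝ (Fin d) × ℝ) := {q | ‖q.1‖ ^ 2 + q.2 ^ 2 = 1} with hS
  have hSc : IsCompact S := by
    refine Metric.isCompact_of_isClosed_isBounded (isClosed_eq (by fun_prop) (by fun_prop)) ?_
    refine (Metric.isBounded_closedBall (x := 0) (r := 1)).subset fun q hq => ?_
    have hq' : ‖q.1‖ ^ 2 + q.2 ^ 2 = 1 := hq
    rw [mem_closedBall_zero_iff, Prod.norm_def, max_le_iff, Real.norm_eq_abs,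
      abs_le_one_iff_mul_self_le_one]
    constructor <;> nlinarith [norm_nonneg q.1, sq_nonneg q.2, sq_nonneg ‖q.1‖]
  have hS0 : S ⊆ {0}ᶜ := by
    rintro q hq rfl
    simp [hS] at hq
  obtain ⟨M, hM⟩ := hSc.exists_bound_of_continuousOn
    ((contDiffOn_dXIter js hO (contDiffOn_rieszKer d β)).continuousOn.mono hS0)
  refine ⟨|M|, abs_nonneg _, fun p hp => ?_⟩
  have hpos := norm_sq_add_sq_pos (upperHalf_subset_compl_zero d hp)
  set ρ := √(‖p.1‖ ^ 2 + p.2 ^ 2) with hρ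
  have hρ0 : 0 < ρ := Real.sqrt_pos.2 hpos
  have hρ2 : ρ ^ 2 = ‖p.1‖ ^ 2 + p.2 ^ 2 := Real.sq_sqrt hpos.le
  have hq : ρ⁻¹ • p ∈ S := by
    simp only [hS, Set.mem_ofPred_eq, Prod.smul_fst, Prod.smul_snd, norm_smul, norm_inv,
      Real.norm_of_nonneg hρ0.le, smul_eq_mul, mul_pow]
    rw [← mul_add, ← hρ2, inv_pow, inv_mul_cancel₀ (by positivity)]
  have hpq : p = ρ • ρ⁻¹ • p := by rw [smul_smul, mul_inv_cancel₀ hρ0.ne', one_smul]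
  have h1 : rieszKer d (β + n) (ρ⁻¹ • p) = 1 := by
    rw [rieszKer, show _ + _ = _ from hq, Real.one_rpow]
  rw [hpq, dXIter_smul js (fun t ht p => rieszKer_smul β ht p) hρ0, rieszKer_smul _ hρ0, h1,
    abs_mul, abs_of_pos (Real.rpow_pos_of_pos hρ0 _), mul_one, mul_comm]
  exact mul_le_mul_of_nonneg_right ((hM _ hq).trans (le_abs_self M)) (by positivity)

lemma dgamma_const_smul {d : ℕ} (γ c : ℝ) (f : EuclideanSpace ℝ (Fin d) × ℝ → ℝ) :
    dgamma d γ (c • f) = c • dgamma d γ f := by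
  have h : ∀ v : EuclideanSpace ℝ (Fin d) × ℝ, (fun q => fderiv ℝ (c • f) q v) =
      c • fun q => fderiv ℝ f q v := fun v => by
    rw [fderiv_const_smul_field]; rfl
  funext p
  have h1 : ∀ v, fderiv ℝ (c • f) p v = c * fderiv ℝ f p v := fun v => congrFun (h v) p
  have h2 : ∀ v, fderiv ℝ (fun q => fderiv ℝ (c • f) q v) p v =
      c * fderiv ℝ (fun q => fderiv ℝ f q v) p v := fun v => by
    rw [h, fderiv_const_smul_field]; rfl
  simp only [dgamma, h1, h2, Pi.smul_apply, smul_eq_mul, ← Finset.mul_sum]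
  ring

/-- The constant produced by applying `Δ_γ` to the Riesz kernel of exponent `α` `m` times. -/
def dgammaConst (d : ℕ) (γ α : ℝ) (m : ℕ) : ℝ :=
  ∏ i ∈ Finset.range m, (α + 2 * i) * (α + 2 * i + 1 - d - γ)

lemma iterate_dgamma_Kext {d : ℕ} (γ α : ℝ) {μ : EuclideanSpace ℝ (Fin d) → ℝ}
    (hμ : Continuous μ) (hc : HasCompactSupport μ) (m : ℕ) :
    Set.EqOn ((dgamma d γ)^[m] (Kext d α μ))
      (dgammaConst d γ α m • Kext d (α + 2 * m) μ) (upperHalf d) := by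
  induction m with
  | zero => intro q _; simp [dgammaConst]
  | succ m ih =>
    intro q hq
    rw [Function.iterate_succ_apply', dgamma_congr_of_eqOn γ ih hq, dgamma_const_smul,
      Pi.smul_apply, Kext_eq_partialConv,
      dgamma_partialConv γ (contDiffOn_upperHalf_rieszKer d _) hμ hc hq, Pi.smul_apply,
      Kext_eq_partialConv, dgammaConst, dgammaConst, Finset.prod_range_succ, mul_smul]
    congr 1
    simp only [partialConv, smul_eq_mul, ← integral_const_mul]
    congr 1
    funext y
    rw [dgamma_rieszKer γ _ (sub_mem_upperHalf hq y),
      show α + 2 * ((m + 1 : ℕ) : ℝ) = α + 2 * m + 2 by push_cast; ring]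
    ring

lemma rpow_add_sq_le {t ξ a b : ℝ} (ht : 0 < t) (hξ : 0 < ξ) (ha : 0 ≤ a) (hb : 0 ≤ b) :
    (t ^ 2 + ξ ^ 2) ^ (-(a + b) / 2) ≤ t ^ (-a) * ξ ^ (-b) := by
  have h : ∀ {u c : ℝ}, 0 < u → u ^ (-c) = (u ^ 2) ^ (-c / 2) := fun {u c} hu => by
    rw [← Real.rpow_natCast, ← Real.rpow_mul hu.le]
    congr 1
    push_cast
    ring
  rw [show -(a + b) / 2 = -a / 2 + -b / 2 by ring, Real.rpow_add (by positivity), h ht, h hξ]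
  gcongr ?_ * ?_
  · exact Real.rpow_le_rpow_of_nonpos (by positivity) (by nlinarith) (by linarith)
  · exact Real.rpow_le_rpow_of_nonpos (by positivity) (by nlinarith) (by linarith)

/-- A two-regime power weight: `ξ^{-b}` for `ξ ≤ 1` and `ξ^{-b'}` for `ξ > 1`. -/
def splitPow (b b' ξ : ℝ) : ℝ := if ξ ≤ 1 then ξ ^ (-b) else ξ ^ (-b')

/-- The power `t^{-a}` truncated to `t ≤ 1`. -/
def truncPow (a t : ℝ) : ℝ := if t ≤ 1 then t ^ (-a) else 0

lemma splitPow_pos {b b' ξ : ℝ} (hξ : 0 < ξ) : 0 < splitPow b b' ξ := by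
  unfold splitPow
  split_ifs <;> positivity

lemma truncPow_nonneg {a t : ℝ} (ht : 0 ≤ t) : 0 ≤ truncPow a t := by
  unfold truncPow
  split_ifs <;> positivity

lemma rpow_add_sq_le_splitPow {t ξ s a b a' b' : ℝ} (ht : 0 < t) (hξ : 0 < ξ)
    (ha : 0 ≤ a) (hb : 0 ≤ b) (ha' : 0 ≤ a') (hb' : 0 ≤ b') (hs : a + b = s) (hs' : a' + b' = s) :
    (t ^ 2 + ξ ^ 2) ^ (-s / 2) ≤
      2 ^ a' * (1 + t) ^ (-a') * splitPow b b' ξ * (1 + truncPow a t) := by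
  have hP : (2 : ℝ) ^ a' * (1 + t) ^ (-a') = ((1 + t) / 2) ^ (-a') := by
    rw [Real.div_rpow (by positivity) (by positivity), Real.rpow_neg (by positivity : (0:ℝ) ≤ 2),
      div_inv_eq_mul, mul_comm]
  have hPpos : 0 < ((1 + t) / 2) ^ (-a') := by positivity
  rw [hP]
  have htr := truncPow_nonneg (a := a) ht.le
  rcases le_or_gt t 1 with h1 | h1
  · have hA : 1 ≤ ((1 + t) / 2) ^ (-a') :=
      Real.one_le_rpow_of_pos_of_le_one_of_nonpos (by positivity) (by linarith) (by linarith)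
    rcases le_or_gt ξ 1 with h2 | h2
    · have := rpow_add_sq_le ht hξ ha hb
      rw [hs] at this
      simp only [splitPow, truncPow, h1, h2, if_true]
      have p1 : 0 < t ^ (-a) := by positivity
      have p2 : 0 < ξ ^ (-b) := by positivity
      calc _ ≤ _ := this
        _ = 1 * ξ ^ (-b) * t ^ (-a) := by ring
        _ ≤ _ := by gcongr; linarith
    · have := rpow_add_sq_le ht hξ le_rfl (b := s) (by linarith)
      rw [zero_add, neg_zero, Real.rpow_zero, one_mul] at this
      have h3 : ξ ^ (-s) ≤ ξ ^ (-b') := Real.rpow_le_rpow_of_exponent_le h2.le (by linarith)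
      simp only [splitPow, h2.not_ge, if_false]
      have p2 : 0 < ξ ^ (-b') := by positivity
      calc _ ≤ _ := this.trans h3
        _ = 1 * ξ ^ (-b') * 1 := by ring
        _ ≤ _ := by gcongr; linarith
  · have hB : t ^ (-a') ≤ ((1 + t) / 2) ^ (-a') :=
      Real.rpow_le_rpow_of_nonpos (by positivity) (by linarith) (by linarith)
    rcases le_or_gt ξ 1 with h2 | h2
    · have := rpow_add_sq_le ht hξ (a := s) (by linarith) le_rfl
      rw [add_zero, neg_zero, Real.rpow_zero, mul_one] at this
      have h3 : t ^ (-s) ≤ t ^ (-a') := Real.rpow_le_rpow_of_exponent_le h1.le (by linarith)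
      have h4 : 1 ≤ ξ ^ (-b) :=
        Real.one_le_rpow_of_pos_of_le_one_of_nonpos hξ h2 (by linarith)
      simp only [splitPow, h2, if_true]
      calc _ ≤ _ := (this.trans h3).trans hB
        _ = ((1 + t) / 2) ^ (-a') * 1 * 1 := by ring
        _ ≤ _ := by gcongr; linarith
    · have := rpow_add_sq_le ht hξ ha' hb'
      rw [hs'] at this
      simp only [splitPow, h2.not_ge, if_false]
      have p2 : 0 < ξ ^ (-b') := by positivity
      calc _ ≤ _ := this
        _ ≤ ((1 + t) / 2) ^ (-a') * ξ ^ (-b') * 1 := by rw [mul_one]; gcongr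
        _ ≤ _ := by gcongr; linarith

lemma integrableOn_rpow_mul_splitPow_sq {γ b b' : ℝ} (hb : 2 * b < 1 + γ) (hb' : 1 + γ < 2 * b') :
    IntegrableOn (fun ξ : ℝ => ξ ^ γ * splitPow b b' ξ ^ 2) (Set.Ioi 0) := by
  have hsq : ∀ {ξ c : ℝ}, 0 < ξ → ξ ^ γ * (ξ ^ (-c)) ^ 2 = ξ ^ (γ - 2 * c) := fun {ξ c} h => by
    rw [← Real.rpow_natCast, ← Real.rpow_mul h.le, ← Real.rpow_add h]
    congr 1
    push_cast
    ring
  rw [← Set.Ioc_union_Ioi_eq_Ioi zero_le_one]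
  refine IntegrableOn.union ?_ ?_
  · have h : IntegrableOn (fun ξ : ℝ => ξ ^ (γ - 2 * b)) (Set.Ioc 0 1) :=
      (intervalIntegrable_iff_integrableOn_Ioc_of_le zero_le_one).1
        (intervalIntegral.intervalIntegrable_rpow' (by linarith))
    refine h.congr_fun (fun ξ hξ => ?_) measurableSet_Ioc
    simp only [splitPow, hξ.2, if_true, hsq hξ.1]
  · have h : IntegrableOn (fun ξ : ℝ => ξ ^ (γ - 2 * b')) (Set.Ioi 1) :=
      integrableOn_Ioi_rpow_of_lt (by linarith) zero_lt_one
    refine h.congr_fun (fun ξ hξ => ?_) measurableSet_Ioi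
    have hξ' : 1 < ξ := hξ
    simp only [splitPow, hξ'.not_ge, if_false, hsq (zero_lt_one.trans hξ')]

lemma integrable_truncPow_norm {d : ℕ} (hd : 0 < d) {a : ℝ} (had : a < d) :
    Integrable fun z : EuclideanSpace ℝ (Fin d) => truncPow a ‖z‖ := by
  have : Nonempty (Fin d) := ⟨⟨0, hd⟩⟩
  rw [integrable_fun_norm_addHaar volume, finrank_euclideanSpace_fin,
    ← Set.Ioc_union_Ioi_eq_Ioi zero_le_one]
  refine IntegrableOn.union ?_ ?_
  · have h : IntegrableOn (fun r : ℝ => r ^ ((d : ℝ) - 1 - a)) (Set.Ioc 0 1) :=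
      (intervalIntegrable_iff_integrableOn_Ioc_of_le zero_le_one).1
        (intervalIntegral.intervalIntegrable_rpow' (by linarith))
    refine h.congr_fun (fun r hr => ?_) measurableSet_Ioc
    simp only [truncPow, hr.2, if_true, smul_eq_mul]
    rw [← Real.rpow_natCast, ← Real.rpow_add hr.1, Nat.cast_sub (by omega)]
    congr 1
    push_cast
    ring
  · refine (integrableOn_zero (s := Set.Ioi (1 : ℝ))).congr_fun (fun r hr => ?_) measurableSet_Ioi
    have hr' : 1 < r := hr
    simp [truncPow, hr'.not_ge]

lemma exists_integral_truncPow_mul_le {d : ℕ} (hd : 0 < d) {a : ℝ} (had : a < d)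
    {μ : EuclideanSpace ℝ (Fin d) → ℝ} (hμ : Continuous μ) (hc : HasCompactSupport μ) :
    ∃ A, ∀ x, Integrable (fun y => (1 + truncPow a ‖x - y‖) * |μ y|) ∧
      ∫ y, (1 + truncPow a ‖x - y‖) * |μ y| ≤ A := by
  obtain ⟨C, hC⟩ := hμ.bounded_above_of_compact_support hc
  have hi : Integrable fun y => |μ y| := (hμ.integrable_of_hasCompactSupport hc).abs
  have hw := integrable_truncPow_norm hd had
  have hwx : ∀ x : EuclideanSpace ℝ (Fin d), Integrable fun y => truncPow a ‖x - y‖ := fun x =>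
    hw.comp_sub_left x
  have hle : ∀ x y : EuclideanSpace ℝ (Fin d), (1 + truncPow a ‖x - y‖) * |μ y| ≤
      |μ y| + truncPow a ‖x - y‖ * C := fun x y => by
    nlinarith [hC y, Real.norm_eq_abs (μ y), truncPow_nonneg (a := a) (norm_nonneg (x - y))]
  have hsum : ∀ x : EuclideanSpace ℝ (Fin d),
      Integrable fun y => |μ y| + truncPow a ‖x - y‖ * C := fun x => hi.add ((hwx x).mul_const C)
  have hint : ∀ x : EuclideanSpace ℝ (Fin d),
      Integrable fun y => (1 + truncPow a ‖x - y‖) * |μ y| := fun x => by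
    refine (hsum x).mono' ?_ (Filter.Eventually.of_forall fun y => ?_)
    · exact ((hwx x).aestronglyMeasurable.const_add 1).mul hi.aestronglyMeasurable
    · rw [Real.norm_of_nonneg (by
        have := truncPow_nonneg (a := a) (norm_nonneg (x - y)); positivity)]
      exact hle x y
  refine ⟨(∫ y, |μ y|) + (∫ z : EuclideanSpace ℝ (Fin d), truncPow a ‖z‖) * C,
    fun x => ⟨hint x, ?_⟩⟩
  refine (integral_mono (hint x) (hsum x) (hle x)).trans_eq ?_
  rw [integral_add hi ((hwx x).mul_const C), integral_mul_const,
    integral_sub_left_eq_self (fun z : EuclideanSpace ℝ (Fin d) => truncPow a ‖z‖)]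

/-- The dominating profile `(1 + |x|)^{-a'}` times `splitPow b b' ξ`. -/
def decayProfile (d : ℕ) (a' b b' : ℝ) (p : EuclideanSpace ℝ (Fin d) × ℝ) : ℝ :=
  (1 + ‖p.1‖) ^ (-a') * splitPow b b' p.2

lemma integrableOn_rpow_mul_decayProfile_sq {d : ℕ} {γ a' b b' : ℝ} (ha' : (d : ℝ) < 2 * a')
    (hb : 2 * b < 1 + γ) (hb' : 1 + γ < 2 * b') :
    IntegrableOn (fun p => p.2 ^ γ * decayProfile d a' b b' p ^ 2) (upperHalf d) := by
  have h1 : Integrable fun x : EuclideanSpace ℝ (Fin d) => (1 + ‖x‖) ^ (-(2 * a')) :=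
    integrable_one_add_norm (by simpa using ha')
  have h2 := integrableOn_rpow_mul_splitPow_sq hb hb'
  have hU : upperHalf d = Set.univ ×ˢ Set.Ioi (0 : ℝ) := by
    ext p
    simp [upperHalf]
  rw [IntegrableOn, hU, Measure.volume_eq_prod, ← Measure.prod_restrict, Measure.restrict_univ]
  refine (h1.mul_prod h2).congr (Filter.Eventually.of_forall fun p => ?_)
  have : (1 + ‖p.1‖) ^ (-(2 * a')) = ((1 + ‖p.1‖) ^ (-a')) ^ 2 := by
    rw [← Real.rpow_natCast, ← Real.rpow_mul (by positivity)]
    congr 1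
    push_cast
    ring
  simp only [decayProfile, this]
  ring

lemma exists_integral_abs_mul_le_decayProfile {d : ℕ} (hd : 0 < d) {s a b a' b' M : ℝ}
    (ha : 0 ≤ a) (hb : 0 ≤ b) (ha' : 0 ≤ a') (hb' : 0 ≤ b') (hs : a + b = s) (hs' : a' + b' = s)
    (had : a < d) {g : EuclideanSpace ℝ (Fin d) × ℝ → ℝ} (hg : ContinuousOn g (upperHalf d))
    (hM : 0 ≤ M) (hgM : ∀ p ∈ upperHalf d, |g p| ≤ M * rieszKer d s p)
    {μ : EuclideanSpace ℝ (Fin d) → ℝ} (hμ : Continuous μ) (hc : HasCompactSupport μ) :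
    ∃ C, 0 ≤ C ∧ ∀ p ∈ upperHalf d,
      ∫ y, |g (p - (y, 0)) * μ y| ≤ C * decayProfile d a' b b' p := by
  obtain ⟨A, hA⟩ := exists_integral_truncPow_mul_le hd had hμ hc
  obtain ⟨R, hR0, hR⟩ := hc.isCompact.isBounded.subset_closedBall_lt 0 0
  have : Nonempty (Fin d) := ⟨⟨0, hd⟩⟩
  have hA0 : 0 ≤ A := le_trans (integral_nonneg fun y => by
    have := truncPow_nonneg (a := a) (norm_nonneg ((0 : EuclideanSpace ℝ (Fin d)) - y))
    simp only [Pi.zero_apply]; positivity) (hA 0).2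
  refine ⟨M * 2 ^ a' * (1 + R) ^ a' * A, by positivity, fun p hp => ?_⟩
  have hp2 : 0 < p.2 := hp
  have hsp := splitPow_pos (b := b) (b' := b') hp2
  set K := M * 2 ^ a' * (1 + R) ^ a' * decayProfile d a' b b' p with hK
  have hK0 : 0 ≤ K := by rw [hK, decayProfile]; positivity
  have hpt : ∀ᵐ y, |g (p - (y, 0)) * μ y| ≤ K * ((1 + truncPow a ‖p.1 - y‖) * |μ y|) := by
    filter_upwards [Measure.ae_ne volume p.1] with y hy
    have htr := truncPow_nonneg (a := a) (norm_nonneg (p.1 - y))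
    by_cases hμy : μ y = 0
    · simp [hμy]
    have hyR : ‖y‖ ≤ R := by simpa using hR (subset_tsupport μ hμy)
    have ht : 0 < ‖p.1 - y‖ := norm_pos_iff.2 (sub_ne_zero.2 hy.symm)
    have h1 := rpow_add_sq_le_splitPow ht hp2 ha hb ha' hb' hs hs'
    have h2 := hgM _ (sub_mem_upperHalf hp y)
    have h3 : (1 + ‖p.1 - y‖) ^ (-a') ≤ (1 + R) ^ a' * (1 + ‖p.1‖) ^ (-a') := by
      have h4 : (1 + ‖p.1‖) / (1 + R) ≤ 1 + ‖p.1 - y‖ := by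
        rw [div_le_iff₀ (by positivity)]
        have := norm_sub_norm_le p.1 y
        nlinarith [norm_nonneg (p.1 - y)]
      have h5 := Real.rpow_le_rpow_of_nonpos (by positivity) h4 (neg_nonpos.2 ha')
      rwa [Real.div_rpow (by positivity) (by positivity), Real.rpow_neg (by positivity : 0 ≤ 1 + R),
        div_inv_eq_mul, mul_comm] at h5
    have h6 : rieszKer d s (p - (y, 0)) ≤ 2 ^ a' * ((1 + R) ^ a' * (1 + ‖p.1‖) ^ (-a')) *
        splitPow b b' p.2 * (1 + truncPow a ‖p.1 - y‖) := by
      simp only [rieszKer, Prod.fst_sub, Prod.snd_sub, sub_zero]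
      exact h1.trans (by gcongr)
    rw [abs_mul, ← mul_assoc]
    gcongr
    calc _ ≤ _ := h2
      _ ≤ _ := mul_le_mul_of_nonneg_left h6 hM
      _ = _ := by rw [hK, decayProfile]; ring
  have hint : Integrable fun y => |g (p - (y, 0)) * μ y| := by
    simpa only [smul_eq_mul, mul_comm] using (integrable_comp_sub_mul hg hμ hc hp).abs
  refine (integral_mono_ae hint ((hA p.1).1.const_mul K) hpt).trans ?_
  rw [integral_const_mul]
  calc _ ≤ K * A := mul_le_mul_of_nonneg_left (hA p.1).2 hK0
    _ = _ := by rw [hK]; ring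

lemma integrable_rpow_mul_mul_mul {d : ℕ} {γ : ℝ} {g : EuclideanSpace ℝ (Fin d) × ℝ → ℝ}
    {h : EuclideanSpace ℝ (Fin d) × ℝ → ℝ}
    (hg : ContinuousOn g (upperHalf d)) (hh : IntegrableOn (fun p => p.2 ^ γ * h p ^ 2) (upperHalf d))
    {μ : EuclideanSpace ℝ (Fin d) → ℝ} (hμ : Continuous μ) (hc : HasCompactSupport μ)
    (hgh : ∀ p ∈ upperHalf d, ∫ y, |g (p - (y, 0)) * μ y| ≤ h p) :
    Integrable (fun w : (EuclideanSpace ℝ (Fin d) × ℝ) ×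
        (EuclideanSpace ℝ (Fin d) × EuclideanSpace ℝ (Fin d)) =>
      w.1.2 ^ γ * (g (w.1 - (w.2.1, 0)) * g (w.1 - (w.2.2, 0))) * (μ w.2.1 * μ w.2.2))
      ((volume.restrict (upperHalf d)).prod volume) := by
  have hU := (isOpen_upperHalf d).measurableSet
  have hcont : ContinuousOn (fun w : (EuclideanSpace ℝ (Fin d) × ℝ) ×
        (EuclideanSpace ℝ (Fin d) × EuclideanSpace ℝ (Fin d)) =>
      w.1.2 ^ γ * (g (w.1 - (w.2.1, 0)) * g (w.1 - (w.2.2, 0))) * (μ w.2.1 * μ w.2.2))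
      (upperHalf d ×ˢ Set.univ) := by
    refine ContinuousOn.mul (ContinuousOn.mul ?_ (ContinuousOn.mul ?_ ?_)) ?_
    · exact ContinuousOn.rpow_const (by fun_prop) fun w hw => Or.inl (ne_of_gt hw.1)
    · exact hg.comp (by fun_prop) fun w hw => sub_mem_upperHalf hw.1 _
    · exact hg.comp (by fun_prop) fun w hw => sub_mem_upperHalf hw.1 _
    · fun_prop
  have hmeas : AEStronglyMeasurable (fun w : (EuclideanSpace ℝ (Fin d) × ℝ) ×
        (EuclideanSpace ℝ (Fin d) × EuclideanSpace ℝ (Fin d)) =>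
      w.1.2 ^ γ * (g (w.1 - (w.2.1, 0)) * g (w.1 - (w.2.2, 0))) * (μ w.2.1 * μ w.2.2))
      ((volume.restrict (upperHalf d)).prod volume) := by
    have := hcont.aestronglyMeasurable (μ := volume.prod volume) (hU.prod MeasurableSet.univ)
    rwa [← Measure.prod_restrict, Measure.restrict_univ] at this
  have hfib : ∀ p ∈ upperHalf d, Integrable fun y => g (p - (y, 0)) * μ y := fun p hp => by
    simpa only [smul_eq_mul, mul_comm] using integrable_comp_sub_mul hg hμ hc hp
  have hsplit : ∀ (p : EuclideanSpace ℝ (Fin d) × ℝ)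
      (z : EuclideanSpace ℝ (Fin d) × EuclideanSpace ℝ (Fin d)),
      p.2 ^ γ * (g (p - (z.1, 0)) * g (p - (z.2, 0))) * (μ z.1 * μ z.2) =
        p.2 ^ γ * ((g (p - (z.1, 0)) * μ z.1) * (g (p - (z.2, 0)) * μ z.2)) := fun p z => by ring
  rw [integrable_prod_iff hmeas]
  constructor
  · filter_upwards [ae_restrict_mem hU] with p hp
    simp only [hsplit]
    exact ((hfib p hp).mul_prod (hfib p hp)).const_mul _
  · refine Integrable.mono' hh hmeas.norm.integral_prod_right' ?_
    filter_upwards [ae_restrict_mem hU] with p hp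
    have hp2 : 0 < p.2 := hp
    have h0 : 0 ≤ ∫ y, |g (p - (y, 0)) * μ y| := integral_nonneg fun y => abs_nonneg _
    rw [Real.norm_of_nonneg (integral_nonneg fun _ => norm_nonneg _)]
    simp only [hsplit, Real.norm_eq_abs, abs_mul (p.2 ^ γ), abs_of_pos (Real.rpow_pos_of_pos hp2 γ)]
    rw [integral_const_mul]
    simp only [abs_mul (g _ * _)]
    rw [Measure.volume_eq_prod, integral_prod_mul (fun y => |g (p - (y, 0)) * μ y|)
      (fun y => |g (p - (y, 0)) * μ y|), ← sq]
    gcongr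
    exact hgh p hp

lemma integral_rpow_mul_sum_partialConv_sq {d : ℕ} {γ : ℝ} {ι : Type*} [Fintype ι]
    {g h : ι → EuclideanSpace ℝ (Fin d) × ℝ → ℝ}
    (hg : ∀ i, ContinuousOn (g i) (upperHalf d))
    (hh : ∀ i, IntegrableOn (fun p => p.2 ^ γ * h i p ^ 2) (upperHalf d))
    {μ : EuclideanSpace ℝ (Fin d) → ℝ} (hμ : Continuous μ) (hc : HasCompactSupport μ)
    (hgh : ∀ i, ∀ p ∈ upperHalf d, ∫ y, |g i (p - (y, 0)) * μ y| ≤ h i p) :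
    IntegrableOn (fun p => p.2 ^ γ * ∑ i, partialConv d μ (g i) p ^ 2) (upperHalf d) ∧
      ∫ p in upperHalf d, p.2 ^ γ * ∑ i, partialConv d μ (g i) p ^ 2 =
        ∫ z : EuclideanSpace ℝ (Fin d) × EuclideanSpace ℝ (Fin d),
          (∫ p in upperHalf d, p.2 ^ γ * ∑ i, g i (p - (z.1, 0)) * g i (p - (z.2, 0))) *
            (μ z.1 * μ z.2) := by
  have hQ := integrable_finsetSum Finset.univ fun i _ =>
    integrable_rpow_mul_mul_mul (hg i) (hh i) hμ hc (hgh i)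
  have hin : ∀ p : EuclideanSpace ℝ (Fin d) × ℝ, p ∈ upperHalf d →
      ∫ z : EuclideanSpace ℝ (Fin d) × EuclideanSpace ℝ (Fin d), ∑ i,
        p.2 ^ γ * (g i (p - (z.1, 0)) * g i (p - (z.2, 0))) * (μ z.1 * μ z.2) =
      p.2 ^ γ * ∑ i, partialConv d μ (g i) p ^ 2 := fun p hp => by
    have hfib : ∀ i, Integrable fun y => g i (p - (y, 0)) * μ y := fun i => by
      simpa only [smul_eq_mul, mul_comm] using integrable_comp_sub_mul (hg i) hμ hc hp
    have hsplit : ∀ (i : ι) (z : EuclideanSpace ℝ (Fin d) × EuclideanSpace ℝ (Fin d)),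
        p.2 ^ γ * (g i (p - (z.1, 0)) * g i (p - (z.2, 0))) * (μ z.1 * μ z.2) =
        p.2 ^ γ * ((g i (p - (z.1, 0)) * μ z.1) * (g i (p - (z.2, 0)) * μ z.2)) :=
      fun i z => by ring
    simp only [hsplit]
    have hi : ∀ i, Integrable fun z : EuclideanSpace ℝ (Fin d) × EuclideanSpace ℝ (Fin d) =>
        p.2 ^ γ * ((g i (p - (z.1, 0)) * μ z.1) * (g i (p - (z.2, 0)) * μ z.2)) :=
      fun i => ((hfib i).mul_prod (hfib i)).const_mul _
    rw [integral_finsetSum _ fun i _ => hi i, Finset.mul_sum]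
    refine Finset.sum_congr rfl fun i _ => ?_
    rw [integral_const_mul, Measure.volume_eq_prod,
      integral_prod_mul (fun y => g i (p - (y, 0)) * μ y) (fun y => g i (p - (y, 0)) * μ y), ← sq]
    rfl
  have hU := (isOpen_upperHalf d).measurableSet
  constructor
  · refine hQ.integral_prod_left.congr ?_
    filter_upwards [ae_restrict_mem hU] with p hp
    exact hin p hp
  · rw [← setIntegral_congr_fun hU hin, integral_integral_swap hQ]
    congr 1
    funext z
    rw [← integral_mul_const]
    congr 1
    funext p
    rw [Finset.mul_sum, Finset.sum_mul]

lemma setIntegral_upperHalf_comp_fst {d : ℕ}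
    (φ : EuclideanSpace ℝ (Fin d) ≃ᵐ EuclideanSpace ℝ (Fin d)) (hφ : MeasurePreserving φ)
    (F : EuclideanSpace ℝ (Fin d) × ℝ → ℝ) :
    ∫ p in upperHalf d, F (φ p.1, p.2) = ∫ p in upperHalf d, F p :=
  (hφ.prod (MeasurePreserving.id volume)).setIntegral_preimage_emb
    (φ.prodCongr (MeasurableEquiv.refl ℝ)).measurableEmbedding F (upperHalf d)

open scoped Pointwise in
lemma setIntegral_upperHalf_comp_smul {d : ℕ} (F : EuclideanSpace ℝ (Fin d) × ℝ → ℝ) {t : ℝ}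
    (ht : 0 < t) :
    ∫ p in upperHalf d, F (t • p) = (t ^ (d + 1))⁻¹ * ∫ p in upperHalf d, F p := by
  have : (volume : Measure (EuclideanSpace ℝ (Fin d) × ℝ)).IsAddHaarMeasure :=
    inferInstanceAs ((volume.prod volume).IsAddHaarMeasure)
  have hU : t • upperHalf d = upperHalf d := by
    ext p
    rw [Set.mem_smul_set_iff_inv_smul_mem₀ ht.ne']
    simp [upperHalf, ht]
  have := Measure.setIntegral_comp_smul_of_pos volume F (upperHalf d) ht
  rwa [hU, Module.finrank_prod, finrank_euclideanSpace_fin, Module.finrank_self, smul_eq_mul] at this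

/-- The interaction kernel `∫_{ξ > 0} ξ^γ ∇_x^n g(x - y, ξ) : ∇_x^n g(x - y', ξ)`. -/
def interactionKer (d n : ℕ) (γ : ℝ) (g : EuclideanSpace ℝ (Fin d) × ℝ → ℝ)
    (y y' : EuclideanSpace ℝ (Fin d)) : ℝ :=
  ∫ p in upperHalf d, p.2 ^ γ * frobeniusX d n g (p - (y, 0)) (p - (y', 0))

lemma interactionKer_eq_sub {d n : ℕ} (γ : ℝ) (g : EuclideanSpace ℝ (Fin d) × ℝ → ℝ)
    (y y' : EuclideanSpace ℝ (Fin d)) :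
    interactionKer d n γ g y y' = interactionKer d n γ g (y - y') 0 := by
  rw [interactionKer, ← setIntegral_upperHalf_comp_fst (MeasurableEquiv.addRight y')
    (measurePreserving_add_right volume y')]
  refine integral_congr_ae (Filter.Eventually.of_forall fun p => ?_)
  simp only [MeasurableEquiv.coe_addRight]
  congr 2 <;> ext <;> simp
  ring

lemma interactionKer_rieszKer_isometry {d n : ℕ} (γ β : ℝ)
    (V : EuclideanSpace ℝ (Fin d) ≃ₗᵢ[ℝ] EuclideanSpace ℝ (Fin d))
    (z : EuclideanSpace ℝ (Fin d)) :
    interactionKer d n γ (rieszKer d β) (V z) 0 = interactionKer d n γ (rieszKer d β) z 0 := by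
  rw [interactionKer, ← setIntegral_upperHalf_comp_fst V.toMeasurableEquiv V.measurePreserving]
  refine setIntegral_congr_fun (isOpen_upperHalf d).measurableSet fun p hp => ?_
  have h := frobeniusX_isometry (n := n) (isOpen_upperHalf d) (contDiffOn_upperHalf_rieszKer d β) V
    (fun p => by simp [rieszKer]) (sub_mem_upperHalf hp z) (sub_mem_upperHalf hp 0)
    (by simpa [upperHalf] using hp) (by simpa [upperHalf] using hp)
  simp only [← h]
  congr 2 <;> ext <;> simp

lemma interactionKer_rieszKer_smul {d n : ℕ} {γ β α : ℝ} (hβ : 2 * (β + n) = d + 1 + γ + α)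
    {t : ℝ} (ht : 0 < t) (z : EuclideanSpace ℝ (Fin d)) :
    interactionKer d n γ (rieszKer d β) (t • z) 0 =
      t ^ (-α) * interactionKer d n γ (rieszKer d β) z 0 := by
  have h := setIntegral_upperHalf_comp_smul (fun p => p.2 ^ γ *
    frobeniusX d n (rieszKer d β) (p - (t • z, 0)) (p - (0, 0))) ht
  have h2 : ∫ p in upperHalf d, (t • p).2 ^ γ *
      frobeniusX d n (rieszKer d β) (t • p - (t • z, 0)) (t • p - (0, 0)) =
      t ^ (γ - 2 * (β + n)) * interactionKer d n γ (rieszKer d β) z 0 := by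
    rw [interactionKer, ← integral_const_mul]
    refine setIntegral_congr_fun (isOpen_upperHalf d).measurableSet fun p hp => ?_
    have hp2 : 0 < p.2 := hp
    have e1 : ∀ w : EuclideanSpace ℝ (Fin d),
        t • p - (t • w, (0 : ℝ)) = t • (p - (w, 0)) := fun w => by ext <;> simp [mul_sub]
    have e2 := e1 0
    rw [smul_zero] at e2
    have e3 : t ^ (γ - 2 * (β + n)) = t ^ γ * (t ^ (-(β + n)) * t ^ (-(β + n))) := by
      rw [← Real.rpow_add ht, ← Real.rpow_add ht]
      congr 1
      ring
    simp only [e1, e2, frobeniusX, dXIter_smul _ (fun t ht p => rieszKer_smul β ht p) ht,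
      Prod.smul_snd, smul_eq_mul, Real.mul_rpow ht.le hp2.le, e3, Finset.mul_sum]
    refine Finset.sum_congr rfl fun js _ => ?_
    ring
  rw [h2] at h
  have h3 : t ^ (-α) = t ^ (d + 1) * t ^ (γ - 2 * (β + n)) := by
    rw [← Real.rpow_natCast, ← Real.rpow_add ht]
    congr 1
    push_cast
    linarith
  rw [h3, mul_assoc, h, mul_inv_cancel_left₀ (by positivity)]
  rfl

lemma interactionKer_rieszKer_eq {d n : ℕ} {γ β α : ℝ} (hα : 0 < α)
    (hβ : 2 * (β + n) = d + 1 + γ + α) {e : EuclideanSpace ℝ (Fin d)} (he : ‖e‖ = 1)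
    (y y' : EuclideanSpace ℝ (Fin d)) :
    interactionKer d n γ (rieszKer d β) y y' =
      interactionKer d n γ (rieszKer d β) e 0 * ‖y - y'‖ ^ (-α) := by
  rw [interactionKer_eq_sub]
  set z := y - y'
  rcases eq_or_ne z 0 with hz | hz
  · have h := interactionKer_rieszKer_smul (n := n) hβ two_pos (0 : EuclideanSpace ℝ (Fin d))
    rw [smul_zero] at h
    have h1 : (2 : ℝ) ^ (-α) < 1 := Real.rpow_lt_one_of_one_lt_of_neg one_lt_two (by linarith)
    have h2 : interactionKer d n γ (rieszKer d β) 0 0 = 0 := by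
      have : (1 - (2 : ℝ) ^ (-α)) * interactionKer d n γ (rieszKer d β) 0 0 = 0 := by linarith
      exact (mul_eq_zero.1 this).resolve_left (by linarith)
    rw [hz, h2, norm_zero, Real.zero_rpow (by linarith), mul_zero]
  · have hz' : 0 < ‖z‖ := norm_pos_iff.2 hz
    have hn : ‖‖z‖ • e‖ = ‖z‖ := by rw [norm_smul, norm_norm, he, mul_one]
    have h := interactionKer_rieszKer_isometry (n := n) γ β
      (Submodule.reflection (ℝ ∙ (‖z‖ • e - z))ᗮ) (‖z‖ • e)
    rw [Submodule.reflection_sub hn, interactionKer_rieszKer_smul hβ hz'] at h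
    rw [h, mul_comm]

/-- The Riesz energy `∬ μ(y) μ(y') |y - y'|^{-α}`. -/
def rieszEnergy (d : ℕ) (α : ℝ) (μ : EuclideanSpace ℝ (Fin d) → ℝ) : ℝ :=
  ∫ z : EuclideanSpace ℝ (Fin d) × EuclideanSpace ℝ (Fin d),
    ‖z.1 - z.2‖ ^ (-α) * (μ z.1 * μ z.2)

/-- Weighted `L²` norms of `∇_x^n` of a Riesz potential are multiples of the Riesz energy. -/
lemma integral_rpow_mul_sum_partialConv_rieszKer_sq {d n : ℕ} {γ β α : ℝ} (hd : 0 < d)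
    (hα : 0 < α) (hαd : α < d) (hγ : -1 < γ)
    (hβ : 2 * (β + n) = d + 1 + γ + α) {e : EuclideanSpace ℝ (Fin d)} (he : ‖e‖ = 1)
    {μ : EuclideanSpace ℝ (Fin d) → ℝ} (hμ : Continuous μ) (hc : HasCompactSupport μ) :
    IntegrableOn (fun p => p.2 ^ γ *
        ∑ js : Fin n → Fin d, partialConv d μ (dXIter d js (rieszKer d β)) p ^ 2) (upperHalf d) ∧
      ∫ p in upperHalf d, p.2 ^ γ *
        ∑ js : Fin n → Fin d, partialConv d μ (dXIter d js (rieszKer d β)) p ^ 2 =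
      interactionKer d n γ (rieszKer d β) e 0 * rieszEnergy d α μ := by
  obtain ⟨b, hb1, hb2⟩ : ∃ b, max 0 (β + n - d) < b ∧ b < (1 + γ) / 2 :=
    exists_between (max_lt (by linarith) (by linarith))
  have hb0 : 0 < b := (le_max_left _ _).trans_lt hb1
  have hbs : β + n - d < b := (le_max_right _ _).trans_lt hb1
  have hd' : (0 : ℝ) < d := by exact_mod_cast hd
  have hg : ∀ js : Fin n → Fin d, ContinuousOn (dXIter d js (rieszKer d β)) (upperHalf d) :=
    fun js => (contDiffOn_dXIter js (isOpen_upperHalf d)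
      (contDiffOn_upperHalf_rieszKer d β)).continuousOn
  have hex : ∀ js : Fin n → Fin d, ∃ C, 0 ≤ C ∧ ∀ p ∈ upperHalf d,
      ∫ y, |dXIter d js (rieszKer d β) (p - (y, 0)) * μ y| ≤
        C * decayProfile d ((d + α / 2) / 2) b ((1 + γ + α / 2) / 2) p := fun js => by
    obtain ⟨M, hM0, hM⟩ := abs_dXIter_rieszKer_le β js
    exact exists_integral_abs_mul_le_decayProfile hd (s := β + n) (a := β + n - b) (by linarith)
      hb0.le (by linarith) (by linarith) (by ring) (by linarith) (by linarith) (hg js) hM0 hM hμ hc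
  choose C hC0 hC using hex
  have hh : ∀ js : Fin n → Fin d, IntegrableOn (fun p => p.2 ^ γ *
      (C js * decayProfile d ((d + α / 2) / 2) b ((1 + γ + α / 2) / 2) p) ^ 2) (upperHalf d) :=
    fun js => by
      refine IntegrableOn.congr_fun (Integrable.const_mul (integrableOn_rpow_mul_decayProfile_sq
        (d := d) (γ := γ) (a' := (d + α / 2) / 2) (b := b) (b' := (1 + γ + α / 2) / 2)
        (by linarith) (by linarith) (by linarith)) (C js ^ 2)) (fun p _ => ?_)
        (isOpen_upperHalf d).measurableSet
      ring
  obtain ⟨h1, h2⟩ := integral_rpow_mul_sum_partialConv_sq hg hh hμ hc hC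
  refine ⟨h1, h2.trans ?_⟩
  rw [rieszEnergy, ← integral_const_mul]
  congr 1
  funext z
  have := interactionKer_rieszKer_eq (n := n) hα hβ he z.1 z.2
  rw [interactionKer] at this
  simp only [frobeniusX] at this
  rw [this, mul_assoc]

lemma interactionKer_rieszKer_ne_zero {d n : ℕ} {γ β α : ℝ} (hd : 0 < d)
    (hα : 0 < α) (hαd : α < d) (hγ : -1 < γ)
    (hβ : 2 * (β + n) = d + 1 + γ + α) {e : EuclideanSpace ℝ (Fin d)} (he : ‖e‖ = 1)
    (js : Fin n → Fin d) (i : Fin d) (ε : ℝ)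
    (hε : ∀ p ∈ upperHalf d, 0 < p.1 i → 0 < ε * dXIter d js (rieszKer d β) p) :
    interactionKer d n γ (rieszKer d β) e 0 ≠ 0 := by
  intro h0
  let μ : ContDiffBump (0 : EuclideanSpace ℝ (Fin d)) := ⟨1 / 2, 1, by norm_num, by norm_num⟩
  have hμ : Continuous μ := μ.continuous
  have hc : HasCompactSupport μ := μ.hasCompactSupport
  have hU := (isOpen_upperHalf d).measurableSet
  obtain ⟨hint, heq⟩ := integral_rpow_mul_sum_partialConv_rieszKer_sq hd hα hαd hγ hβ he hμ hc
  rw [h0, zero_mul] at heq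
  have hnn : 0 ≤ᵐ[volume.restrict (upperHalf d)] fun p => p.2 ^ γ *
      ∑ js : Fin n → Fin d, partialConv d μ (dXIter d js (rieszKer d β)) p ^ 2 := by
    filter_upwards [ae_restrict_mem hU] with p hp
    have hp2 : 0 < p.2 := hp
    exact mul_nonneg (by positivity) (Finset.sum_nonneg fun _ _ => sq_nonneg _)
  refine (lt_irrefl (0 : ℝ)) (lt_of_lt_of_eq ?_ heq)
  rw [setIntegral_pos_iff_support_of_nonneg_ae hnn hint]
  have hW : IsOpen {p : EuclideanSpace ℝ (Fin d) × ℝ | 1 < p.1 i ∧ 0 < p.2} :=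
    (isOpen_lt continuous_const (by fun_prop : Continuous fun p : EuclideanSpace ℝ (Fin d) × ℝ =>
      p.1 i)).inter (isOpen_upperHalf d)
  have : (volume : Measure (EuclideanSpace ℝ (Fin d) × ℝ)).IsAddHaarMeasure :=
    inferInstanceAs ((volume.prod volume).IsAddHaarMeasure)
  refine (hW.measure_pos volume ⟨(EuclideanSpace.single i 2, 1), by simp⟩).trans_le
    (measure_mono ?_)
  rintro p ⟨hp1, hp⟩
  have hp2 : 0 < p.2 := hp
  refine ⟨ne_of_gt (mul_pos (by positivity) ?_), hp⟩
  refine (sq_pos_of_ne_zero ?_).trans_le (Finset.single_le_sum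
    (f := fun js : Fin n → Fin d => partialConv d μ (dXIter d js (rieszKer d β)) p ^ 2)
    (fun _ _ => sq_nonneg _) (Finset.mem_univ js))
  have hg : ContinuousOn (dXIter d js (rieszKer d β)) (upperHalf d) :=
    (contDiffOn_dXIter js (isOpen_upperHalf d) (contDiffOn_upperHalf_rieszKer d β)).continuousOn
  have hcont : Continuous fun y => μ y * (ε * dXIter d js (rieszKer d β) (p - (y, 0))) :=
    continuous_comp_sub_mul (g := fun q => ε * dXIter d js (rieszKer d β) q)
      (continuousOn_const.mul hg) hμ hp
  have hpos : ∀ y, μ y ≠ 0 → 0 < ε * dXIter d js (rieszKer d β) (p - (y, 0)) := fun y hy => by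
    refine hε _ (sub_mem_upperHalf hp y) ?_
    have hy1 : y ∈ Metric.ball (0 : EuclideanSpace ℝ (Fin d)) 1 := by
      rw [← μ.support_eq]
      exact hy
    have hy2 : y i < 1 := (le_abs_self _).trans_lt
      ((PiLp.norm_apply_le y i).trans_lt (by simpa using hy1))
    simp only [Prod.fst_sub, PiLp.sub_apply]
    linarith
  have hμ0 : 0 < μ 0 := by
    rw [μ.one_of_mem_closedBall (by simp [μ])]
    exact one_pos
  have hI := hcont.integral_pos_of_hasCompactSupport_nonneg_nonzero (μ := volume) hc.mul_right
    (fun y => by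
      by_cases hy : μ y = 0
      · simp [hy]
      · exact mul_nonneg μ.nonneg (hpos y hy).le) (x := 0)
    (mul_pos hμ0 (hpos 0 hμ0.ne')).ne'
  intro h
  have : ∫ y, μ y * (ε * dXIter d js (rieszKer d β) (p - (y, 0))) =
      ε * partialConv d μ (dXIter d js (rieszKer d β)) p := by
    rw [partialConv, ← integral_const_mul]
    congr 1
    funext y
    ring
  rw [this, h, mul_zero] at hI
  exact lt_irrefl _ hI

lemma interactionKer_rieszKer_zero_ne_zero {d : ℕ} {γ β α : ℝ} (hd : 0 < d)
    (hα : 0 < α) (hαd : α < d) (hγ : -1 < γ)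
    (hβ : 2 * β = d + 1 + γ + α) {e : EuclideanSpace ℝ (Fin d)} (he : ‖e‖ = 1) :
    interactionKer d 0 γ (rieszKer d β) e 0 ≠ 0 := by
  refine interactionKer_rieszKer_ne_zero hd hα hαd hγ (by simpa using hβ) he Fin.elim0 ⟨0, hd⟩ 1
    fun p hp _ => ?_
  have := norm_sq_add_sq_pos (upperHalf_subset_compl_zero d hp)
  simp only [dXIter, List.ofFn_zero, List.foldr_nil, rieszKer, one_mul]
  positivity

lemma interactionKer_rieszKer_one_ne_zero {d : ℕ} {γ β α : ℝ} (hd : 0 < d) (hβ0 : 0 < β)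
    (hα : 0 < α) (hαd : α < d) (hγ : -1 < γ)
    (hβ : 2 * (β + 1) = d + 1 + γ + α) {e : EuclideanSpace ℝ (Fin d)} (he : ‖e‖ = 1) :
    interactionKer d 1 γ (rieszKer d β) e 0 ≠ 0 := by
  refine interactionKer_rieszKer_ne_zero hd hα hαd hγ (by simpa using hβ) he
    (fun _ => ⟨0, hd⟩) ⟨0, hd⟩ (-1) fun p hp hpi => ?_
  have hp0 : p ≠ 0 := upperHalf_subset_compl_zero d hp
  have := norm_sq_add_sq_pos hp0
  have h2 : 0 < rieszKer d (β + 2) p := by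
    unfold rieszKer
    positivity
  simp only [dXIter, List.ofFn_succ, List.ofFn_zero, List.foldr_nil, List.foldr_cons, dX]
  rw [fderiv_rieszKer_apply β hp0]
  simp only [EuclideanSpace.inner_single_right, mul_zero, add_zero, one_mul, conj_trivial]
  have : 0 < β * p.1 ⟨0, hd⟩ * rieszKer d (β + 2) p := by positivity
  linarith

lemma dXIter_congr_of_eqOn {d n : ℕ} (js : Fin n → Fin d)
    {f g : EuclideanSpace ℝ (Fin d) × ℝ → ℝ} (h : Set.EqOn f g (upperHalf d)) :
    Set.EqOn (dXIter d js f) (dXIter d js g) (upperHalf d) := by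
  unfold dXIter
  induction List.ofFn js with
  | nil => exact h
  | cons i l ih => exact fderiv_apply_congr_of_eqOn (isOpen_upperHalf d) ih _

lemma dXIter_const_smul {d n : ℕ} (js : Fin n → Fin d) (c : ℝ)
    (g : EuclideanSpace ℝ (Fin d) × ℝ → ℝ) : dXIter d js (c • g) = c • dXIter d js g := by
  unfold dXIter
  induction List.ofFn js with
  | nil => rfl
  | cons i l ih =>
    simp only [List.foldr_cons, ih]
    funext p
    simp only [dX, fderiv_const_smul_field]
    rfl

/-- The weighted energy of `∇_x^n Δ_γ^m` of an extended potential is a multiple of the Riesz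
energy whenever the orders match. -/
lemma integral_rpow_mul_sum_dXIter_iterate_dgamma_Kext_sq {d n m : ℕ} {γ α : ℝ} (hd : 0 < d)
    (hα : 0 < α) (hαd : α < d) (hγ : -1 < γ)
    (hβ : 2 * (α + 2 * m + n) = d + 1 + γ + α) {e : EuclideanSpace ℝ (Fin d)} (he : ‖e‖ = 1)
    {μ : EuclideanSpace ℝ (Fin d) → ℝ} (hμ : Continuous μ) (hc : HasCompactSupport μ) :
    ∫ p in upperHalf d, p.2 ^ γ *
        ∑ js : Fin n → Fin d, dXIter d js ((dgamma d γ)^[m] (Kext d α μ)) p ^ 2 =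
      dgammaConst d γ α m ^ 2 * interactionKer d n γ (rieszKer d (α + 2 * m)) e 0 *
        rieszEnergy d α μ := by
  rw [mul_assoc, ← (integral_rpow_mul_sum_partialConv_rieszKer_sq hd hα hαd hγ hβ he hμ hc).2,
    ← integral_const_mul]
  refine setIntegral_congr_fun (isOpen_upperHalf d).measurableSet fun p hp => ?_
  have h : ∀ js : Fin n → Fin d, dXIter d js ((dgamma d γ)^[m] (Kext d α μ)) p =
      dgammaConst d γ α m * partialConv d μ (dXIter d js (rieszKer d (α + 2 * m))) p :=
    fun js => by
      rw [dXIter_congr_of_eqOn js (iterate_dgamma_Kext γ α hμ hc m) hp, dXIter_const_smul,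
        Kext_eq_partialConv, Pi.smul_apply, smul_eq_mul,
        dXIter_partialConv js (contDiffOn_upperHalf_rieszKer d _) hμ hc hp]
  simp only [h, mul_pow, ← Finset.mul_sum]
  ring

lemma dgammaConst_ne_zero {d j m : ℕ} {γ α : ℝ} (hα : 0 < α) (hγ : γ = α - d + 2 * j + 1)
    (hm : ∀ i < m, i < j) : dgammaConst d γ α m ≠ 0 := by
  refine Finset.prod_ne_zero_iff.2 fun i hi => mul_ne_zero (by positivity) ?_
  have : (i : ℝ) < j := by exact_mod_cast hm i (Finset.mem_range.1 hi)
  intro h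
  linarith

lemma exists_pos_forall_mul_le (a : ℝ) {b : ℝ} (hb : b ≠ 0) :
    ∃ C, 0 < C ∧ ∀ E, 0 ≤ b * E → a * E ≤ C * (b * E) := by
  refine ⟨|a / b| + 1, by positivity, fun E hE => ?_⟩
  have h : a * E = a / b * (b * E) := by field_simp
  rw [h]
  exact mul_le_mul_of_nonneg_right ((le_abs_self _).trans (by linarith)) hE

/-- For `max(0,d-2j-2) < α < d-2j` and `γ = α-d+2j+1`, there is `C > 0`
depending only on `α, d, j` such that for every `μ ∈ C_c^∞(ℝ^d)`:
if `j` is odd, `∬ ξ^γ |∇_x^{j+1} 𝒦_{μ,α}|² ≤ C ∬ ξ^γ |Δ_γ^{(j+1)/2} 𝒦_{μ,α}|²`;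
if `j` is even, `∬ ξ^γ |∇_x^{j+1} 𝒦_{μ,α}|² ≤ C ∬ ξ^γ |∇_x Δ_γ^{j/2} 𝒦_{μ,α}|²`. -/
theorem stmt_13 (d j : ℕ) (α γ : ℝ)
    (hα₁ : max 0 ((d : ℝ) - 2 * j - 2) < α) (hα₂ : α < (d : ℝ) - 2 * j)
    (hγ : γ = α - d + 2 * j + 1) :
    ∃ C : ℝ, 0 < C ∧
      ∀ μ : EuclideanSpace ℝ (Fin d) → ℝ,
        ContDiff ℝ (⊤ : ℕ∞) μ → HasCompactSupport μ →
        (Odd j →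
          (∫ q in {q : EuclideanSpace ℝ (Fin d) × ℝ | 0 < q.2},
              q.2 ^ γ * ∑ js : Fin (j + 1) → Fin d,
                (dXIter d js (Kext d α μ) q) ^ 2)
            ≤ C * ∫ q in {q : EuclideanSpace ℝ (Fin d) × ℝ | 0 < q.2},
                q.2 ^ γ * ((dgamma d γ)^[(j + 1) / 2] (Kext d α μ) q) ^ 2) ∧
        (Even j →
          (∫ q in {q : EuclideanSpace ℝ (Fin d) × ℝ | 0 < q.2},
              q.2 ^ γ * ∑ js : Fin (j + 1) → Fin d,
                (dXIter d js (Kext d α μ) q) ^ 2)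
            ≤ C * ∫ q in {q : EuclideanSpace ℝ (Fin d) × ℝ | 0 < q.2},
                q.2 ^ γ * ∑ i : Fin d,
                  (dX d i ((dgamma d γ)^[j / 2] (Kext d α μ)) q) ^ 2) := by
  have hα : 0 < α := (le_max_left _ _).trans_lt hα₁
  have hα' : (d : ℝ) - 2 * j - 2 < α := (le_max_right _ _).trans_lt hα₁
  have hj : (0 : ℝ) ≤ j := j.cast_nonneg
  have hαd : α < d := by linarith
  have hd : 0 < d := by exact_mod_cast hα.trans hαd
  have hγ1 : -1 < γ := by linarith
  set e : EuclideanSpace ℝ (Fin d) := EuclideanSpace.single ⟨0, hd⟩ 1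
  have he : ‖e‖ = 1 := by simp [e]
  have hnonneg : ∀ {F : EuclideanSpace ℝ (Fin d) × ℝ → ℝ}, (∀ q, 0 ≤ F q) →
      0 ≤ ∫ q in upperHalf d, q.2 ^ γ * F q := fun {F} hF =>
    setIntegral_nonneg (isOpen_upperHalf d).measurableSet fun q hq =>
      mul_nonneg (Real.rpow_nonneg (le_of_lt hq) γ) (hF q)
  have hL := fun {μ : EuclideanSpace ℝ (Fin d) → ℝ} (hμ : Continuous μ)
      (hc : HasCompactSupport μ) =>
    integral_rpow_mul_sum_dXIter_iterate_dgamma_Kext_sq (n := j + 1) (m := 0) (γ := γ) hd hα hαd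
      hγ1 (by push_cast; linarith) he hμ hc
  rcases Nat.even_or_odd j with hev | hodd
  · obtain ⟨m, hm⟩ := hev.two_dvd
    have hm' : j / 2 = m := by omega
    have hmj : (j : ℝ) = 2 * m := by exact_mod_cast hm
    have hR := fun {μ : EuclideanSpace ℝ (Fin d) → ℝ} (hμ : Continuous μ)
        (hc : HasCompactSupport μ) =>
      integral_rpow_mul_sum_dXIter_iterate_dgamma_Kext_sq (n := 1) (m := m) (γ := γ) hd hα hαd
        hγ1 (by push_cast; linarith) he hμ hc
    have hb := mul_ne_zero (pow_ne_zero 2 (dgammaConst_ne_zero (m := m) hα hγ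
      fun i hi => by omega)) (interactionKer_rieszKer_one_ne_zero (β := α + 2 * m) hd
        (by positivity) hα hαd hγ1 (by linarith) he)
    obtain ⟨C, hC0, hC⟩ := exists_pos_forall_mul_le (dgammaConst d γ α 0 ^ 2 *
      interactionKer d (j + 1) γ (rieszKer d (α + 2 * (0 : ℕ))) e 0) hb
    refine ⟨C, hC0, fun μ hμ hc =>
      ⟨fun h => absurd hev (Nat.not_even_iff_odd.2 h), fun _ => ?_⟩⟩
    have hR' := hR hμ.continuous hc
    have hnn := hR'.symm.trans_ge (hnonneg fun q => Finset.sum_nonneg fun js _ => sq_nonneg _)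
    refine ((hL hμ.continuous hc).trans_le (hC _ hnn)).trans_eq ?_
    rw [← hR', hm']
    congr 2
    funext q
    congr 1
    exact Fintype.sum_equiv (Equiv.funUnique (Fin 1) (Fin d)) _ _ fun js => rfl
  · obtain ⟨k, hk⟩ := hodd
    have hm' : (j + 1) / 2 = k + 1 := by omega
    have hkj : (j : ℝ) = 2 * k + 1 := by exact_mod_cast hk
    have hR := fun {μ : EuclideanSpace ℝ (Fin d) → ℝ} (hμ : Continuous μ)
        (hc : HasCompactSupport μ) =>
      integral_rpow_mul_sum_dXIter_iterate_dgamma_Kext_sq (n := 0) (m := k + 1) (γ := γ) hd hα hαd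
        hγ1 (by push_cast; linarith) he hμ hc
    have hb := mul_ne_zero (pow_ne_zero 2 (dgammaConst_ne_zero (m := k + 1) hα hγ
      fun i hi => by omega)) (interactionKer_rieszKer_zero_ne_zero
        (β := α + 2 * (k + 1 : ℕ)) hd hα hαd hγ1 (by push_cast; linarith) he)
    obtain ⟨C, hC0, hC⟩ := exists_pos_forall_mul_le (dgammaConst d γ α 0 ^ 2 *
      interactionKer d (j + 1) γ (rieszKer d (α + 2 * (0 : ℕ))) e 0) hb
    refine ⟨C, hC0, fun μ hμ hc =>
      ⟨fun _ => ?_, fun h => absurd h (Nat.not_even_iff_odd.2 ⟨k, hk⟩)⟩⟩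
    have hR' := hR hμ.continuous hc
    have hnn := hR'.symm.trans_ge (hnonneg fun q => Finset.sum_nonneg fun js _ => sq_nonneg _)
    refine ((hL hμ.continuous hc).trans_le (hC _ hnn)).trans_eq ?_
    rw [← hR', hm']
    congr 2
    funext q
    congr 1
    exact Fintype.sum_unique _
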